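/- Let (G, Γ*) be a self-similar groupoid with associated inverse semigroup S = S_{(G,Γ*)}. Then S is 0-simple if and only if for each pair of distinct vertices v, w ∈ Γ⁰ there exist paths p ∈ wΓ* and q ∈ vΓ* such that G intersects Iso(r(p), v) and G intersects Iso(r(q), w). -/

import Mathlib

set_option autoImplicit false

/-! ## Directed graphs and path trees -/

/-- A row-finite directed graph. -/
structure DirGraph where
  V : Type
  E : Type
  src : E → V
  rng : E → V
  rowFinite : ∀ v : V, {e : E | src e = v}.Finite

/-- `Γ.IsPathFrom v l` : the list of edges `l` is a (finite) path with source `v`. -/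
def DirGraph.IsPathFrom (Γ : DirGraph) : Γ.V → List Γ.E → Prop
  | _, [] => True
  | v, e :: l => Γ.src e = v ∧ DirGraph.IsPathFrom Γ (Γ.rng e) l

/-- The range (terminal vertex) of a path with source `v` and edge list `l`. -/
def DirGraph.rng0 (Γ : DirGraph) : Γ.V → List Γ.E → Γ.V
  | v, [] => v
  | _, e :: l => DirGraph.rng0 Γ (Γ.rng e) l

/-- An isomorphism of rooted path trees `(dom)Γ* → (cod)Γ*`: a bijection between the
paths with source `dom` and the paths with source `cod` which fixes the root and maps
children to children (equivalently, a directed-graph isomorphism of the rooted trees). -/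
structure Arrow (Γ : DirGraph) where
  dom : Γ.V
  cod : Γ.V
  act : List Γ.E → List Γ.E
  inv : List Γ.E → List Γ.E
  act_maps : ∀ l, Γ.IsPathFrom dom l → Γ.IsPathFrom cod (act l)
  inv_maps : ∀ l, Γ.IsPathFrom cod l → Γ.IsPathFrom dom (inv l)
  left_inv : ∀ l, Γ.IsPathFrom dom l → inv (act l) = l
  right_inv : ∀ l, Γ.IsPathFrom cod l → act (inv l) = l
  act_nil : act [] = []
  act_snoc : ∀ l e, Γ.IsPathFrom dom (l ++ [e]) → ∃ e', act (l ++ [e]) = act l ++ [e']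

/-- The identity tree isomorphism at a vertex `v`. -/
def Arrow.idArrow (Γ : DirGraph) (v : Γ.V) : Arrow Γ where
  dom := v
  cod := v
  act := fun l => l
  inv := fun l => l
  act_maps := fun _ h => h
  inv_maps := fun _ h => h
  left_inv := fun _ _ => rfl
  right_inv := fun _ _ => rfl
  act_nil := rfl
  act_snoc := fun _ e _ => ⟨e, rfl⟩

namespace Arrow

variable {Γ : DirGraph}

/-- Two arrows represent the same tree isomorphism (they agree on all genuine paths). -/
def Same (g h : Arrow Γ) : Prop :=
  g.dom = h.dom ∧ g.cod = h.cod ∧ ∀ l, Γ.IsPathFrom g.dom l → g.act l = h.act l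

/-- `k` represents the identity isomorphism of `v Γ*`. -/
def IsIdArrow (v : Γ.V) (k : Arrow Γ) : Prop :=
  k.dom = v ∧ k.cod = v ∧ ∀ l, Γ.IsPathFrom v l → k.act l = l

/-- `k` represents the composition `g ∘ h` (first `h`, then `g`). -/
def IsComposition (g h k : Arrow Γ) : Prop :=
  h.cod = g.dom ∧ k.dom = h.dom ∧ k.cod = g.cod ∧
  ∀ l, Γ.IsPathFrom h.dom l → k.act l = g.act (h.act l)

/-- `k` represents the inverse isomorphism of `g`. -/
def IsInverseArrow (g k : Arrow Γ) : Prop :=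
  k.dom = g.cod ∧ k.cod = g.dom ∧ ∀ l, Γ.IsPathFrom g.dom l → k.act (g.act l) = l

/-- `h` represents the restriction `g|_p` of `g` to the path `p`, characterized by
`g(pq) = g(p)·h(q)` for all paths `q` with source `r(p)`. -/
def IsRestrictOf (g : Arrow Γ) (p : List Γ.E) (h : Arrow Γ) : Prop :=
  h.dom = Γ.rng0 g.dom p ∧ h.cod = Γ.rng0 g.cod (g.act p) ∧
  ∀ q, Γ.IsPathFrom (Γ.rng0 g.dom p) q → g.act (p ++ q) = g.act p ++ h.act q

end Arrow

/-! ## Self-similar groupoids -/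

/-- A self-similar groupoid `(G, Γ*)` : a set of tree isomorphisms (closed under
representing-the-same-isomorphism) which contains all the identities, is closed under
composition and inverses (a groupoid with object set `Γ⁰` acting faithfully on `Γ*`),
and is closed under restriction: for every `g ∈ G` and edge `e` in the domain of `g`
there is `g|_e ∈ G` with `g(ep) = g(e)·g|_e(p)`. -/
structure SSG (Γ : DirGraph) where
  carrier : Set (Arrow Γ)
  satur : ∀ g g', g ∈ carrier → g.Same g' → g' ∈ carrier
  id_mem : ∀ v, Arrow.idArrow Γ v ∈ carrier
  comp_mem : ∀ g h k, g ∈ carrier → h ∈ carrier → Arrow.IsComposition g h k → k ∈ carrier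
  inv_mem : ∀ g k, g ∈ carrier → Arrow.IsInverseArrow g k → k ∈ carrier
  restrict_mem : ∀ g ∈ carrier, ∀ e : Γ.E, Γ.src e = g.dom →
    ∃ h ∈ carrier, g.IsRestrictOf [e] h

/-- The condition: for each pair of distinct vertices `v, w` there exist paths
`p ∈ wΓ*` and `q ∈ vΓ*` such that `G` intersects `Iso(r(p), v)` and `Iso(r(q), w)`. -/
def OrbitCond (Γ : DirGraph) (Gs : SSG Γ) : Prop :=
  ∀ v w : Γ.V, v ≠ w →
    (∃ p, Γ.IsPathFrom w p ∧ ∃ g ∈ Gs.carrier, g.dom = Γ.rng0 w p ∧ g.cod = v) ∧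
    (∃ q, Γ.IsPathFrom v q ∧ ∃ g ∈ Gs.carrier, g.dom = Γ.rng0 v q ∧ g.cod = w)

/-- Type (CF): every vertex emits more than one edge, and the orbit condition holds. -/
def TypeCF (Γ : DirGraph) (Gs : SSG Γ) : Prop :=
  (∀ v : Γ.V, ∃ e f : Γ.E, e ≠ f ∧ Γ.src e = v ∧ Γ.src f = v) ∧ OrbitCond Γ Gs

/-! ## Contracting self-similar groupoids, nuclei, recurrent subgroups -/

/-- Every element of `G` eventually restricts into `A`. -/
def ContractsInto {Γ : DirGraph} (Gs : SSG Γ) (A : Set (Arrow Γ)) : Prop :=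
  ∀ g ∈ Gs.carrier, ∃ n : ℕ, ∀ l, Γ.IsPathFrom g.dom l → l.length = n →
    ∃ h ∈ A, g.IsRestrictOf l h

/-- A set of arrows covering only finitely many tree isomorphisms. -/
def FinUpToSame {Γ : DirGraph} (A : Set (Arrow Γ)) : Prop :=
  ∃ B : Finset (Arrow Γ), ∀ g ∈ A, ∃ h ∈ B, g.Same h

/-- `(G, Γ*)` is contracting. -/
def IsContracting {Γ : DirGraph} (Gs : SSG Γ) : Prop :=
  ∃ A : Set (Arrow Γ), A ⊆ Gs.carrier ∧ FinUpToSame A ∧ ContractsInto Gs A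

/-- `N` is the nucleus of `(G, Γ*)` : a minimal finite subset of `G` into which every
element of `G` eventually restricts. -/
def IsNucleus {Γ : DirGraph} (Gs : SSG Γ) (N : Set (Arrow Γ)) : Prop :=
  N ⊆ Gs.carrier ∧ FinUpToSame N ∧ ContractsInto Gs N ∧
  ∀ A : Set (Arrow Γ), A ⊆ Gs.carrier → FinUpToSame A → ContractsInto Gs A →
    ∀ g ∈ N, ∃ h ∈ A, g.Same h

/-- The recurrent set `H_p = {g ∈ G : g(p) = p, g|_p = g}` for a path `p ∈ vΓ*`. -/
def Hp {Γ : DirGraph} (Gs : SSG Γ) (v : Γ.V) (p : List Γ.E) : Set (Arrow Γ) :=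
  {g | g ∈ Gs.carrier ∧ g.dom = v ∧ g.cod = v ∧ g.act p = p ∧ g.IsRestrictOf p g}

/-! ## The associated inverse semigroup `S_{(G,Γ*)}` -/

/-- The product in `S` of a path: `p = e₁ e₂ ⋯ eₙ · r(p)` (just `v` for the empty path). -/
def pathProd {Γ : DirGraph} {S : Type} (mul : S → S → S) (ιV : Γ.V → S) (ιE : Γ.E → S)
    (v : Γ.V) (p : List Γ.E) : S :=
  p.foldr (fun e a => mul (ιE e) a) (ιV (Γ.rng0 v p))

/-- The inverse semigroup with zero `S_{(G,Γ*)}` associated to a self-similar groupoid,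
presented through its characterizing properties: it is an inverse semigroup with zero,
generated by `Γ⁰ ∪ Γ¹ ∪ Γ⁻¹ ∪ G` subject to the defining relations, in which every
nonzero element has a unique canonical form `p g q*`. -/
structure AssocISG (Γ : DirGraph) (Gs : SSG Γ) where
  S : Type
  mul : S → S → S
  zero : S
  star : S → S
  mul_assoc : ∀ a b c, mul (mul a b) c = mul a (mul b c)
  zero_mul : ∀ a, mul zero a = zero
  mul_zero : ∀ a, mul a zero = zero
  inv_ax : ∀ a, mul (mul a (star a)) a = a ∧ mul (mul (star a) a) (star a) = star a
  inv_unique : ∀ a b, mul (mul a b) a = a → mul (mul b a) b = b → b = star a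
  ιV : Γ.V → S
  ιE : Γ.E → S
  ιG : Arrow Γ → S
  ιG_same : ∀ g h, g.Same h → ιG g = ιG h
  rel_src : ∀ e, mul (ιV (Γ.src e)) (ιE e) = ιE e
  rel_rng : ∀ e, mul (ιE e) (ιV (Γ.rng e)) = ιE e
  rel_vv : ∀ u v, u ≠ v → mul (ιV u) (ιV v) = zero
  rel_v_idem : ∀ v, mul (ιV v) (ιV v) = ιV v
  rel_star_v : ∀ v, star (ιV v) = ιV v
  rel_ef : ∀ e f, e ≠ f → mul (star (ιE e)) (ιE f) = zero
  rel_ee : ∀ e, mul (star (ιE e)) (ιE e) = ιV (Γ.rng e)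
  rel_comp : ∀ g h k, g ∈ Gs.carrier → h ∈ Gs.carrier → Arrow.IsComposition g h k →
    mul (ιG g) (ιG h) = ιG k
  rel_notcomp : ∀ g h, g ∈ Gs.carrier → h ∈ Gs.carrier → h.cod ≠ g.dom →
    mul (ιG g) (ιG h) = zero
  rel_star : ∀ g k, g ∈ Gs.carrier → Arrow.IsInverseArrow g k → star (ιG g) = ιG k
  rel_id : ∀ v, ιG (Arrow.idArrow Γ v) = ιV v
  rel_ge : ∀ g ∈ Gs.carrier, ∀ (e e' : Γ.E) (h : Arrow Γ), Γ.src e = g.dom →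
    g.act [e] = [e'] → g.IsRestrictOf [e] h → mul (ιG g) (ιE e) = mul (ιE e') (ιG h)
  canon_ex : ∀ s, s ≠ zero → ∃ (v w : Γ.V) (p q : List Γ.E) (g : Arrow Γ),
    Γ.IsPathFrom v p ∧ Γ.IsPathFrom w q ∧ g ∈ Gs.carrier ∧
    g.dom = Γ.rng0 w q ∧ g.cod = Γ.rng0 v p ∧
    s = mul (mul (pathProd mul ιV ιE v p) (ιG g)) (star (pathProd mul ιV ιE w q))
  canon_nonzero : ∀ (v w : Γ.V) (p q : List Γ.E) (g : Arrow Γ),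
    Γ.IsPathFrom v p → Γ.IsPathFrom w q → g ∈ Gs.carrier →
    g.dom = Γ.rng0 w q → g.cod = Γ.rng0 v p →
    mul (mul (pathProd mul ιV ιE v p) (ιG g)) (star (pathProd mul ιV ιE w q)) ≠ zero
  canon_inj : ∀ (v w v' w' : Γ.V) (p q p' q' : List Γ.E) (g g' : Arrow Γ),
    Γ.IsPathFrom v p → Γ.IsPathFrom w q → g ∈ Gs.carrier →
    g.dom = Γ.rng0 w q → g.cod = Γ.rng0 v p →
    Γ.IsPathFrom v' p' → Γ.IsPathFrom w' q' → g' ∈ Gs.carrier →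
    g'.dom = Γ.rng0 w' q' → g'.cod = Γ.rng0 v' p' →
    mul (mul (pathProd mul ιV ιE v p) (ιG g)) (star (pathProd mul ιV ιE w q)) =
      mul (mul (pathProd mul ιV ιE v' p') (ιG g')) (star (pathProd mul ιV ιE w' q')) →
    v = v' ∧ w = w' ∧ p = p' ∧ q = q' ∧ g.Same g'

namespace AssocISG

variable {Γ : DirGraph} {Gs : SSG Γ}

/-- The element of `S` represented by a path. -/
def P (T : AssocISG Γ Gs) (v : Γ.V) (p : List Γ.E) : T.S :=
  pathProd T.mul T.ιV T.ιE v p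

def IsIdem (T : AssocISG Γ Gs) (e : T.S) : Prop := T.mul e e = e

/-- The natural partial order on idempotents: `f ≤ e` iff `f = g e` for an idempotent `g`. -/
def idemLe (T : AssocISG Γ Gs) (f e : T.S) : Prop := ∃ g, T.IsIdem g ∧ f = T.mul g e

/-- A congruence on `S`. -/
def IsCongruence (T : AssocISG Γ Gs) (r : T.S → T.S → Prop) : Prop :=
  Equivalence r ∧ ∀ a b c, r a b → r (T.mul c a) (T.mul c b) ∧ r (T.mul a c) (T.mul b c)

/-- `S` is congruence-free: its only congruences are equality and the universal relation. -/
def CongruenceFree (T : AssocISG Γ Gs) : Prop :=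
  ∀ r, T.IsCongruence r → (∀ a b, r a b ↔ a = b) ∨ (∀ a b, r a b)

/-- `S` is fundamental. -/
def Fundamental (T : AssocISG Γ Gs) : Prop :=
  ∀ a b : T.S,
    (∀ e, T.IsIdem e → T.mul (T.mul a e) (T.star a) = T.mul (T.mul b e) (T.star b)) → a = b

/-- `S` is 0-simple: its only (two-sided semigroup) ideals are `{0}` and `S`. -/
def ZeroSimple (T : AssocISG Γ Gs) : Prop :=
  ∀ J : Set T.S, J.Nonempty → (∀ s x, x ∈ J → T.mul s x ∈ J ∧ T.mul x s ∈ J) →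
    J = {T.zero} ∨ J = Set.univ

/-- The semilattice of idempotents of `S` is 0-disjunctive. -/
def ZeroDisjunctive (T : AssocISG Γ Gs) : Prop :=
  ∀ e f, T.IsIdem e → T.IsIdem f → e ≠ T.zero → f ≠ T.zero → e ≠ f →
    ∃ h, T.IsIdem h ∧ Xor' (T.mul e h = T.zero) (T.mul f h = T.zero)

end AssocISG

/-! ## The contracted inverse semigroup algebra `K S_{(G,Γ*)}` -/

/-- The contracted inverse semigroup algebra of `S_{(G,Γ*)}` over a field `K` :
a (possibly nonunital) `K`-algebra with basis `S ∖ {0}` and multiplication extending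
that of `S` (identifying the zeros of `S` and `K`). -/
structure ContractedAlg (K : Type) [Field K] {Γ : DirGraph} {Gs : SSG Γ}
    (T : AssocISG Γ Gs) where
  A : Type
  [ringA : NonUnitalRing A]
  [modA : Module K A]
  smul_mul : ∀ (k : K) (a b : A), (k • a) * b = k • (a * b)
  mul_smul_comm : ∀ (k : K) (a b : A), a * (k • b) = k • (a * b)
  δ : T.S → A
  δ_zero : δ T.zero = 0
  δ_mul : ∀ s t, δ (T.mul s t) = δ s * δ t
  indep : LinearIndependent K (fun s : {s : T.S // s ≠ T.zero} => δ s.1)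
  spans : ∀ a : A, a ∈ Submodule.span K (Set.range (fun s : {s : T.S // s ≠ T.zero} => δ s.1))

attribute [instance] ContractedAlg.ringA ContractedAlg.modA

/-- Product of a list in a (nonunital) ring, with the empty product read as `0`. -/
def listProd {A : Type} [Mul A] [Zero A] : List A → A
  | [] => 0
  | a :: l => l.foldl (· * ·) a

namespace ContractedAlg

variable {K : Type} [Field K] {Γ : DirGraph} {Gs : SSG Γ} {T : AssocISG Γ Gs}

/-- A (two-sided, `K`-linear) ideal of the algebra, as a set. -/
def IsIdealSet (C : ContractedAlg K T) (J : Set C.A) : Prop :=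
  (0 : C.A) ∈ J ∧ (∀ x y, x ∈ J → y ∈ J → x + y ∈ J) ∧ (∀ x, x ∈ J → -x ∈ J) ∧
  (∀ (k : K) x, x ∈ J → k • x ∈ J) ∧
  (∀ x y, x ∈ J → y * x ∈ J) ∧ (∀ x y, x ∈ J → x * y ∈ J)

/-- The ideal generated by a set. -/
def idealGen (C : ContractedAlg K T) (X : Set C.A) : Set C.A :=
  ⋂₀ {J | C.IsIdealSet J ∧ X ⊆ J}

/-- The generators `∏_{f ∈ F} (e - f)` of the tight ideal, for `e` a nonzero idempotent
and `F` a finite cover of `e`. -/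
def tightGens (C : ContractedAlg K T) : Set C.A :=
  {x | ∃ (e : T.S) (l : List T.S), T.IsIdem e ∧ e ≠ T.zero ∧ l ≠ [] ∧
    (∀ f ∈ l, T.IsIdem f ∧ T.idemLe f e) ∧
    (∀ g, T.IsIdem g → g ≠ T.zero → T.idemLe g e → ∃ f ∈ l, T.mul g f ≠ T.zero) ∧
    x = listProd (l.map fun f => C.δ e - C.δ f)}

/-- The tight ideal of `K S_{(G,Γ*)}`. -/
def Itight (C : ContractedAlg K T) : Set C.A := C.idealGen C.tightGens

/-- The Cuntz–Krieger generators `v - ∑_{e ∈ vΓ¹} e e*`. -/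
def ckGens (C : ContractedAlg K T) : Set C.A :=
  {x | ∃ v : Γ.V,
    x = C.δ (T.ιV v) -
      ∑ e ∈ (Γ.rowFinite v).toFinset, C.δ (T.mul (T.ιE e) (T.star (T.ιE e)))}

/-- The Cuntz–Krieger ideal of `K S_{(G,Γ*)}`. -/
def Ick (C : ContractedAlg K T) : Set C.A := C.idealGen C.ckGens

/-- An element `a` is singular: for every nonzero idempotent `e` there is a nonzero
idempotent `f ≤ e` with `a f = 0`. -/
def IsSingular (C : ContractedAlg K T) (a : C.A) : Prop :=
  ∀ e, T.IsIdem e → e ≠ T.zero →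
    ∃ f, T.IsIdem f ∧ f ≠ T.zero ∧ T.idemLe f e ∧ a * C.δ f = 0

/-- The essential (singular) ideal of `K S_{(G,Γ*)}`. -/
def Iess (C : ContractedAlg K T) : Set C.A := {a | C.IsSingular a}

/-- The quotient of the algebra by the ideal `I` is simple. -/
def QuotSimple (C : ContractedAlg K T) (I : Set C.A) : Prop :=
  I ≠ Set.univ ∧ ∀ J, C.IsIdealSet J → I ⊆ J → J = I ∨ J = Set.univ

end ContractedAlg
/-! ## Collapsing self-similar groupoids -/

/-- A morphism of directed graphs. -/
structure GraphHom (Γ Λ : DirGraph) where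
  vmap : Γ.V → Λ.V
  emap : Γ.E → Λ.E
  hsrc : ∀ e, Λ.src (emap e) = vmap (Γ.src e)
  hrng : ∀ e, Λ.rng (emap e) = vmap (Γ.rng e)

/-- The induced map on paths. -/
def GraphHom.pmap {Γ Λ : DirGraph} (β : GraphHom Γ Λ) (l : List Γ.E) : List Λ.E :=
  l.map β.emap

/-- `F` is a system of collapsing isomorphisms for `(G, Γ*)` : a wide subgroupoid of `G`
containing all identities, with at most one arrow between any two objects, and with an
arrow `u → v` whenever `G` has one (as produced by choosing orbit representatives `R`
and isomorphisms `f_u` with `id_u = f_u⁻¹ id_v f_u`). -/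
def IsFsystem {Γ : DirGraph} (Gs : SSG Γ) (F : Set (Arrow Γ)) : Prop :=
  F ⊆ Gs.carrier ∧
  (∀ g g', g ∈ F → g.Same g' → g' ∈ F) ∧
  (∀ v, Arrow.idArrow Γ v ∈ F) ∧
  (∀ g h k, g ∈ F → h ∈ F → Arrow.IsComposition g h k → k ∈ F) ∧
  (∀ g k, g ∈ F → Arrow.IsInverseArrow g k → k ∈ F) ∧
  (∀ g g', g ∈ F → g' ∈ F → g.dom = g'.dom → g.cod = g'.cod → g.Same g') ∧
  (∀ g ∈ Gs.carrier, ∃ f ∈ F, f.dom = g.dom ∧ f.cod = g.cod)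

/-- `β : Γ → Λ` is the quotient graph morphism determined by `F` : it is surjective and
locally bijective, its vertex fibres are exactly the `F`-orbits of vertices, and it is
invariant under the action of `F` on paths (so that the fibres on paths are exactly the
`∼_F`-classes). -/
def IsCollapse {Γ Λ : DirGraph} (Gs : SSG Γ) (F : Set (Arrow Γ)) (β : GraphHom Γ Λ) : Prop :=
  Function.Surjective β.vmap ∧
  (∀ v : Γ.V, Set.BijOn β.emap {e | Γ.src e = v} {e' | Λ.src e' = β.vmap v}) ∧
  (∀ u v : Γ.V, β.vmap u = β.vmap v ↔ ∃ f ∈ F, f.dom = u ∧ f.cod = v) ∧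
  (∀ f ∈ F, ∀ l, Γ.IsPathFrom f.dom l → β.pmap (f.act l) = β.pmap l)

/-- `m` is the tree isomorphism of `Λ*` induced by `g` under the identification `β`
(the image `α(g)` of `g` in the collapsed groupoid). -/
def IsPushArrow {Γ Λ : DirGraph} (β : GraphHom Γ Λ) (g : Arrow Γ) (m : Arrow Λ) : Prop :=
  m.dom = β.vmap g.dom ∧ m.cod = β.vmap g.cod ∧
  ∀ l, Γ.IsPathFrom g.dom l → m.act (β.pmap l) = β.pmap (g.act l)

/-- The collapsed groupoid `L = α(G)`, acting on `Λ*`. -/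
def Lcarrier {Γ Λ : DirGraph} (Gs : SSG Γ) (β : GraphHom Γ Λ) : Set (Arrow Λ) :=
  {m | ∃ g ∈ Gs.carrier, IsPushArrow β g m}

/-! ## The graph Δ : cycles of the Moore diagram, the sets `I_q`, synchronization -/

/-- Membership in `N` up to representing the same tree isomorphism. -/
def memSame {Γ : DirGraph} (N : Set (Arrow Γ)) (g : Arrow Γ) : Prop :=
  ∃ h ∈ N, g.Same h

/-- The set `C` of elements of the nucleus `N` lying on a nonempty cycle of the subgraph
`H` of the Moore diagram of `N` consisting of the edges labelled `(e, e)` : `g ∈ C` iff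
`g ∈ N` and there is a nonempty path `p` with `g(p) = p`, `g|_p = g`, and all the
intermediate restrictions `g|_{p'}` (for prefixes `p'` of `p`) in `N`. -/
def Cset {Γ : DirGraph} (N : Set (Arrow Γ)) : Set (Arrow Γ) :=
  {g | memSame N g ∧ ∃ p : List Γ.E, p ≠ [] ∧ Γ.IsPathFrom g.dom p ∧ g.act p = p ∧
    g.IsRestrictOf p g ∧
    ∀ l₁ l₂ : List Γ.E, p = l₁ ++ l₂ → ∃ h, memSame N h ∧ g.IsRestrictOf l₁ h}

/-- The vertex `I_q = q · {id_{r(q)}} = {g ∈ C : g(q) = q, g|_q = id}` of `Δ`,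
for a path `q ∈ vΓ*`. -/
def Iq {Γ : DirGraph} (N : Set (Arrow Γ)) (v : Γ.V) (q : List Γ.E) : Set (Arrow Γ) :=
  {g | g ∈ Cset N ∧ g.dom = v ∧ g.cod = v ∧
    ∀ w, Γ.IsPathFrom (Γ.rng0 v q) w → g.act (q ++ w) = q ++ w}

/-- The path `p ∈ vΓ*` is synchronizing in `Δ` : every path of `Δ` labelled by the
reversal of `p` ends at the same vertex, i.e. `I_{pq} = I_{pq'}` for all `q, q' ∈ r(p)Γ*`. -/
def Synchronizing {Γ : DirGraph} (N : Set (Arrow Γ)) (v : Γ.V) (p : List Γ.E) : Prop :=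
  Γ.IsPathFrom v p ∧
  ∀ q q', Γ.IsPathFrom (Γ.rng0 v p) q → Γ.IsPathFrom (Γ.rng0 v p) q' →
    Iq N v (p ++ q) = Iq N v (p ++ q')

/-- A vertex `X` of `Δ` is synchronized: `X = I_w` for some synchronizing path `w`. -/
def SyncVertex {Γ : DirGraph} (N : Set (Arrow Γ)) (X : Set (Arrow Γ)) : Prop :=
  ∃ v p, Synchronizing N v p ∧ X = Iq N v p

/-- The vertex set `Q = {I_q : q ∈ Γ*}` of the Schreier graph `Δ`. -/
def Qset {Γ : DirGraph} (N : Set (Arrow Γ)) : Set (Set (Arrow Γ)) :=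
  {X | ∃ v q, Γ.IsPathFrom v q ∧ X = Iq N v q}

/-- The edge relation of `Δ` : an edge labelled `e` from `I_q` to `I_{eq}`. -/
def DeltaStep {Γ : DirGraph} (N : Set (Arrow Γ)) (X Y : Set (Arrow Γ)) : Prop :=
  ∃ v q e, Γ.IsPathFrom v q ∧ Γ.rng e = v ∧ X = Iq N v q ∧ Y = Iq N (Γ.src e) (e :: q)

/-- Reachability in `Δ`. -/
def DeltaReaches {Γ : DirGraph} (N : Set (Arrow Γ)) : Set (Arrow Γ) → Set (Arrow Γ) → Prop :=
  Relation.ReflTransGen (DeltaStep N)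

/-- A vertex of `Δ` lying in a minimal strongly connected component with respect to
reachability. -/
def DeltaMinVert {Γ : DirGraph} (N : Set (Arrow Γ)) (X : Set (Arrow Γ)) : Prop :=
  X ∈ Qset N ∧ ∀ Y ∈ Qset N, DeltaReaches N X Y → DeltaReaches N Y X

/- `π_{p,q}(a) = 0` for `a = ∑_{g ∈ Tset} c_g · g ∈ K H_p`, where
`π_{p,q} : K H_p → K[H_p / (H_p ∩ I_q)]` is induced by the canonical map of `H_p` onto
the left cosets of `H_p ∩ I_q` : the sum of the coefficients over each left coset of
`H_p ∩ I_q` vanishes. -/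
open Classical in
def PiZero (K : Type) [Field K] {Γ : DirGraph} (Gs : SSG Γ) (N : Set (Arrow Γ))
    (v : Γ.V) (p q : List Γ.E) (Tset : Finset (Arrow Γ)) (c : Arrow Γ → K) : Prop :=
  ∀ g₀ ∈ Hp Gs v p,
    (∑ h ∈ Tset,
      if ∃ k, k ∈ Hp Gs v p ∧ k ∈ Iq N v q ∧ Arrow.IsComposition g₀ k h then c h else 0) = 0

/-! ## Inverses of arrows -/

theorem DirGraph.IsPathFrom.of_append {Γ : DirGraph} :
    ∀ {v : Γ.V} {l l' : List Γ.E}, Γ.IsPathFrom v (l ++ l') → Γ.IsPathFrom v l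
  | _, [], _, _ => trivial
  | _, _ :: _, _, h => ⟨h.1, DirGraph.IsPathFrom.of_append h.2⟩

namespace Arrow

variable {Γ : DirGraph}

/-- The inverse tree isomorphism. -/
def symm (g : Arrow Γ) : Arrow Γ where
  dom := g.cod
  cod := g.dom
  act := g.inv
  inv := g.act
  act_maps := g.inv_maps
  inv_maps := g.act_maps
  left_inv := g.right_inv
  right_inv := g.left_inv
  act_nil := by simpa [g.act_nil] using g.left_inv [] trivial
  act_snoc := fun l e h => by
    have hpath := g.inv_maps _ h
    have hact := g.right_inv _ h
    rcases List.eq_nil_or_concat (g.inv (l ++ [e])) with hm | ⟨m, f, hm⟩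
    · rw [hm, g.act_nil] at hact
      simp at hact
    · rw [List.concat_eq_append] at hm
      rw [hm] at hpath hact
      obtain ⟨f', hf'⟩ := g.act_snoc m f hpath
      have hl : g.act m = l := (List.append_inj' (hf'.symm.trans hact) rfl).1
      exact ⟨f, by rw [hm, ← hl, g.left_inv m hpath.of_append]⟩

theorem isInverseArrow_symm (g : Arrow Γ) : g.IsInverseArrow g.symm :=
  ⟨rfl, rfl, g.left_inv⟩

theorem isComposition_symm (g : Arrow Γ) : IsComposition g g.symm (idArrow Γ g.cod) :=
  ⟨rfl, rfl, rfl, fun l h => (g.right_inv l h).symm⟩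

theorem isComposition_idArrow_right (g : Arrow Γ) : IsComposition g (idArrow Γ g.dom) g :=
  ⟨rfl, rfl, rfl, fun _ _ => rfl⟩

theorem isComposition_idArrow_left (g : Arrow Γ) : IsComposition (idArrow Γ g.cod) g g :=
  ⟨rfl, rfl, rfl, fun _ _ => rfl⟩

end Arrow

/-! ## Products with vertices, paths and arrows -/

namespace AssocISG

variable {Γ : DirGraph} {Gs : SSG Γ}

theorem P_cons (T : AssocISG Γ Gs) (v : Γ.V) (e : Γ.E) (l : List Γ.E) :
    T.P v (e :: l) = T.mul (T.ιE e) (T.P (Γ.rng e) l) := rfl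

theorem ιV_mul_P (T : AssocISG Γ Gs) {v : Γ.V} {p : List Γ.E} (h : Γ.IsPathFrom v p) :
    T.mul (T.ιV v) (T.P v p) = T.P v p := by
  cases p with
  | nil => exact T.rel_v_idem v
  | cons e l =>
    obtain ⟨rfl, -⟩ := h
    rw [P_cons, ← T.mul_assoc, T.rel_src]

theorem ιV_mul_P_of_ne (T : AssocISG Γ Gs) {u v : Γ.V} {p : List Γ.E} (h : Γ.IsPathFrom v p)
    (huv : u ≠ v) : T.mul (T.ιV u) (T.P v p) = T.zero := by
  rw [← T.ιV_mul_P h, ← T.mul_assoc, T.rel_vv u v huv, T.zero_mul]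

theorem P_mul_ιV (T : AssocISG Γ Gs) (v : Γ.V) (p : List Γ.E) :
    T.mul (T.P v p) (T.ιV (Γ.rng0 v p)) = T.P v p := by
  induction p generalizing v with
  | nil => exact T.rel_v_idem v
  | cons e l ih => rw [P_cons, T.mul_assoc]; exact congrArg _ (ih _)

theorem star_P_mul_P (T : AssocISG Γ Gs) {v : Γ.V} {p : List Γ.E} (h : Γ.IsPathFrom v p) :
    T.mul (T.star (T.P v p)) (T.P v p) = T.ιV (Γ.rng0 v p) := by
  obtain ⟨b, hb, hb'⟩ : ∃ b, T.mul b (T.P v p) = T.ιV (Γ.rng0 v p) ∧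
      T.mul (T.ιV (Γ.rng0 v p)) b = b := by
    induction p generalizing v with
    | nil => exact ⟨T.ιV v, T.rel_v_idem v, T.rel_v_idem v⟩
    | cons e l ih =>
      obtain ⟨b, hb, hb'⟩ := ih h.2
      refine ⟨T.mul b (T.star (T.ιE e)), ?_, ?_⟩
      · rw [P_cons, T.mul_assoc, ← T.mul_assoc (T.star _), T.rel_ee, T.ιV_mul_P h.2]
        exact hb
      · rw [← T.mul_assoc]
        exact congrArg (fun x => T.mul x _) hb'
  rw [← T.inv_unique (T.P v p) b (by rw [T.mul_assoc, hb, P_mul_ιV]) (by rw [hb, hb']), hb]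

theorem ιG_mul_ιV_dom (T : AssocISG Γ Gs) {g : Arrow Γ} (hg : g ∈ Gs.carrier) :
    T.mul (T.ιG g) (T.ιV g.dom) = T.ιG g := by
  rw [← T.rel_id]
  exact T.rel_comp _ _ _ hg (Gs.id_mem _) g.isComposition_idArrow_right

theorem ιV_cod_mul_ιG (T : AssocISG Γ Gs) {g : Arrow Γ} (hg : g ∈ Gs.carrier) :
    T.mul (T.ιV g.cod) (T.ιG g) = T.ιG g := by
  rw [← T.rel_id]
  exact T.rel_comp _ _ _ (Gs.id_mem _) hg g.isComposition_idArrow_left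

theorem ιG_mul_ιG_symm (T : AssocISG Γ Gs) {g : Arrow Γ} (hg : g ∈ Gs.carrier) :
    T.mul (T.ιG g) (T.ιG g.symm) = T.ιV g.cod := by
  rw [← T.rel_id]
  exact T.rel_comp _ _ _ hg (Gs.inv_mem _ _ hg g.isInverseArrow_symm) g.isComposition_symm

theorem exists_canonical (T : AssocISG Γ Gs) {s : T.S} (hs : s ≠ T.zero) :
    ∃ (v w : Γ.V) (p q : List Γ.E) (g : Arrow Γ), Γ.IsPathFrom v p ∧ Γ.IsPathFrom w q ∧
      g ∈ Gs.carrier ∧ g.dom = Γ.rng0 w q ∧ g.cod = Γ.rng0 v p ∧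
      s = T.mul (T.mul (T.P v p) (T.ιG g)) (T.star (T.P w q)) :=
  T.canon_ex s hs

theorem canonical_idArrow (T : AssocISG Γ Gs) (v : Γ.V) (p : List Γ.E) :
    T.mul (T.mul (T.P v p) (T.ιG (Arrow.idArrow Γ (Γ.rng0 v p)))) (T.star (T.P v p)) =
      T.mul (T.P v p) (T.star (T.P v p)) := by
  rw [T.rel_id, P_mul_ιV]

theorem P_nil_mul_star (T : AssocISG Γ Gs) (v : Γ.V) :
    T.mul (T.P v []) (T.star (T.P v [])) = T.ιV v := by
  change T.mul (T.ιV v) (T.star (T.ιV v)) = T.ιV v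
  rw [T.rel_star_v, T.rel_v_idem]

theorem ιV_ne_zero (T : AssocISG Γ Gs) (v : Γ.V) : T.ιV v ≠ T.zero := by
  rw [← P_nil_mul_star, ← canonical_idArrow]
  exact T.canon_nonzero v v [] [] _ trivial trivial (Gs.id_mem _) rfl rfl

/-- The range projection of a path is a vertex only for paths of length `0`. -/
theorem eq_nil_of_P_mul_star_P_eq_ιV (T : AssocISG Γ Gs) {v : Γ.V} {p : List Γ.E}
    (h : Γ.IsPathFrom v p) (hp : T.mul (T.P v p) (T.star (T.P v p)) = T.ιV v) : p = [] := by
  rw [← P_nil_mul_star, ← canonical_idArrow, ← canonical_idArrow] at hp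
  exact (T.canon_inj v v v v p p [] [] _ _ h h (Gs.id_mem _) rfl rfl trivial trivial
    (Gs.id_mem _) rfl rfl hp).2.2.1

theorem exists_arrow_of_ιV_eq (T : AssocISG Γ Gs) {v w : Γ.V} {a b : T.S}
    (h : T.ιV v = T.mul (T.mul a (T.ιV w)) b) :
    ∃ p, Γ.IsPathFrom w p ∧ ∃ g ∈ Gs.carrier, g.dom = Γ.rng0 w p ∧ g.cod = v := by
  have hb : b ≠ T.zero := by
    rintro rfl
    exact T.ιV_ne_zero v (by rw [h, T.mul_zero])
  obtain ⟨w', v', p, q, g, hp, hq, hg, hdom, hcod, rfl⟩ := T.exists_canonical hb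
  have hw : w = w' := by
    by_contra hne
    refine T.ιV_ne_zero v ?_
    rw [h, T.mul_assoc, ← T.mul_assoc (T.ιV w), ← T.mul_assoc (T.ιV w),
      T.ιV_mul_P_of_ne hp hne]
    simp only [T.zero_mul, T.mul_zero]
  have hproj : T.mul (T.ιV v) (T.mul (T.P v' q) (T.star (T.P v' q))) = T.ιV v := by
    rw [h]
    simp only [T.mul_assoc]
    rw [← T.mul_assoc (T.star _) (T.P v' q), (T.inv_ax _).2]
  have hv : v = v' := by
    by_contra hne
    rw [← T.mul_assoc, T.ιV_mul_P_of_ne hq hne, T.zero_mul] at hproj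
    exact T.ιV_ne_zero v hproj.symm
  subst hw hv
  rw [← T.mul_assoc, T.ιV_mul_P hq] at hproj
  obtain rfl := T.eq_nil_of_P_mul_star_P_eq_ιV hq hproj
  exact ⟨p, hp, g.symm, Gs.inv_mem _ _ hg g.isInverseArrow_symm, hcod, hdom⟩

theorem ZeroSimple.exists_arrow {T : AssocISG Γ Gs} (hT : T.ZeroSimple) (v w : Γ.V) :
    ∃ p, Γ.IsPathFrom w p ∧ ∃ g ∈ Gs.carrier, g.dom = Γ.rng0 w p ∧ g.cod = v := by
  have hw : T.ιV w ∈ {s | ∃ a b, s = T.mul (T.mul a (T.ιV w)) b} :=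
    ⟨T.ιV w, T.ιV w, by rw [T.rel_v_idem, T.rel_v_idem]⟩
  rcases hT {s | ∃ a b, s = T.mul (T.mul a (T.ιV w)) b} ⟨_, hw⟩ (by
    rintro s _ ⟨a, b, rfl⟩
    exact ⟨⟨T.mul s a, b, by simp only [T.mul_assoc]⟩,
      ⟨a, T.mul b s, by simp only [T.mul_assoc]⟩⟩) with hJ | hJ
  · rw [hJ] at hw
    exact absurd hw (T.ιV_ne_zero w)
  · obtain ⟨a, b, hab⟩ : T.ιV v ∈ {s | ∃ a b, s = T.mul (T.mul a (T.ιV w)) b} :=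
      hJ ▸ Set.mem_univ _
    exact T.exists_arrow_of_ιV_eq hab

theorem zeroSimple_of_orbitCond (T : AssocISG Γ Gs) (h : OrbitCond Γ Gs) : T.ZeroSimple := by
  intro J hJne hJ
  have hG : ∀ {g : Arrow Γ}, g ∈ Gs.carrier → T.ιG g ∈ J → T.ιV g.cod ∈ J := fun hg hgJ =>
    T.ιG_mul_ιG_symm hg ▸ (hJ _ _ hgJ).2
  have hzero : T.zero ∈ J := by
    obtain ⟨x, hx⟩ := hJne
    exact T.zero_mul x ▸ (hJ T.zero x hx).1
  rw [or_iff_not_imp_left]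
  intro hne
  obtain ⟨x, hx, hx0⟩ : ∃ x ∈ J, x ≠ T.zero := by
    by_contra! hall
    exact hne (Set.eq_singleton_iff_unique_mem.2 ⟨hzero, hall⟩)
  obtain ⟨u, hu⟩ : ∃ u, T.ιV u ∈ J := by
    obtain ⟨v, w, p, q, g, hp, hq, hg, hdom, hcod, rfl⟩ := T.exists_canonical hx0
    refine ⟨g.cod, hG hg ?_⟩
    have hmem := (hJ (T.P w q) _ (hJ (T.star (T.P v p)) _ hx).1).2
    rwa [T.mul_assoc, T.mul_assoc, T.star_P_mul_P hq, ← hdom, T.mul_assoc, T.ιG_mul_ιV_dom hg,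
      ← T.mul_assoc, T.star_P_mul_P hp, ← hcod, T.ιV_cod_mul_ιG hg] at hmem
  have hV : ∀ w, T.ιV w ∈ J := by
    intro w
    by_cases huw : u = w
    · exact huw ▸ hu
    · obtain ⟨q, hq, g, hg, hdom, rfl⟩ := (h u w huw).2
      refine hG hg ?_
      have hmem := (hJ (T.star (T.P u q)) _ (hJ (T.P u q) _ hu).2).1
      rw [T.ιV_mul_P hq, T.star_P_mul_P hq, ← hdom] at hmem
      exact T.ιG_mul_ιV_dom hg ▸ (hJ (T.ιG g) _ hmem).1
  refine Set.eq_univ_of_forall fun s => ?_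
  by_cases hs : s = T.zero
  · exact hs ▸ hzero
  · obtain ⟨v, w, p, q, g, hp, -, -, -, -, rfl⟩ := T.exists_canonical hs
    rw [← T.ιV_mul_P hp]
    simp only [T.mul_assoc]
    exact (hJ _ _ (hV v)).2

end AssocISG

/-! ## STATEMENT 3 -/

/-- Theorem: `S_{(G,Γ*)}` is 0-simple iff for each pair of distinct vertices `v, w` there
exist paths `p ∈ wΓ*` and `q ∈ vΓ*` such that `G` intersects `Iso(r(p), v)` and
`Iso(r(q), w)`. -/
theorem statement3 (Γ : DirGraph) (Gs : SSG Γ) (T : AssocISG Γ Gs) :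
    T.ZeroSimple ↔ OrbitCond Γ Gs := by
  refine ⟨fun hT v w _ => ⟨hT.exists_arrow v w, hT.exists_arrow w v⟩,
    T.zeroSimple_of_orbitCond⟩
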